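/- There is a universal constant C such that for every weighted graph G=(V,E,w) on n ≥ 2 vertices with root r ∈ V and every ε ∈ (0,1), there exists an online algorithm for online partial group Steiner tree on G (the f-partial problem with f_i = |g_i|/2 for every group g_i) that is (1−ε)-connection-competitive and C·(log³n/ε)-cost-competitive, i.e., for every request sequence and every t, H_t connects at least (1−ε)·|g_i|/2 vertices of each g_i (i ≤ t) to r and w(H_t) ≤ C·(log³n/ε)·OPT_t. -/

import Mathlib

/-- An edge set `F` connects vertices `u` and `v` if they lie in the same connected
component of the graph with edge set `F`. -/
def EdgeConn {V : Type*} (F : Set (Sym2 V)) (u v : V) : Prop :=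
  (SimpleGraph.fromEdgeSet F).Reachable u v

/-- The number of vertices of the group `g` that the edge set `H` connects to `r`. -/
noncomputable def connVerts {V : Type*} (r : V) (H : Finset (Sym2 V)) (g : Set V) : ℕ :=
  {v ∈ g | EdgeConn (↑H) v r}.ncard

/-- The edge `e` crosses the cut `S`. -/
def Crosses {V : Type*} (S : Set V) (e : Sym2 V) : Prop :=
  ∃ u ∈ S, ∃ v ∉ S, e = s(u, v)

open Classical in
/-- Under the edge capacities `x` on `E`, every cut separating `v` from `r` has capacity at
least `c`. -/
def FracConn {V : Type*} (E : Finset (Sym2 V)) (x : Sym2 V → ℝ) (r : V) (c : ℝ) (v : V) : Prop :=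
  ∀ S : Set V, v ∈ S → r ∉ S → c ≤ ∑ e ∈ E with Crosses S e, x e

/-- The absolute difference of `φ` across an edge. -/
def edgeDiff {V : Type*} (φ : V → ℝ) (e : Sym2 V) : ℝ :=
  Sym2.lift ⟨fun a b => |φ a - φ b|, fun a b => abs_sub_comm (φ a) (φ b)⟩ e

@[simp] lemma edgeDiff_mk {V : Type*} (φ : V → ℝ) (a b : V) :
    edgeDiff φ s(a, b) = |φ a - φ b| := rfl

lemma edgeDiff_nonneg {V : Type*} (φ : V → ℝ) (e : Sym2 V) : 0 ≤ edgeDiff φ e := by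
  induction e with
  | h a b => exact abs_nonneg _

lemma crosses_mk {V : Type*} (S : Set V) (a b : V) :
    Crosses S s(a, b) ↔ (a ∈ S ∧ b ∉ S) ∨ (b ∈ S ∧ a ∉ S) := by
  constructor
  · rintro ⟨u, hu, v, hv, h⟩
    rcases Sym2.eq_iff.1 h with ⟨rfl, rfl⟩ | ⟨rfl, rfl⟩
    · exact Or.inl ⟨hu, hv⟩
    · exact Or.inr ⟨hu, hv⟩
  · rintro (⟨h1, h2⟩ | ⟨h1, h2⟩)
    · exact ⟨a, h1, b, h2, rfl⟩
    · exact ⟨b, h1, a, h2, Sym2.eq_swap⟩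

lemma EdgeConn.mono {V : Type*} {F F' : Set (Sym2 V)} (h : F ⊆ F') {u v : V}
    (huv : EdgeConn F u v) : EdgeConn F' u v :=
  SimpleGraph.Reachable.mono (SimpleGraph.fromEdgeSet_mono h) huv

lemma EdgeConn.exists_crosses {V : Type*} {F : Set (Sym2 V)} {v r : V} (h : EdgeConn F v r)
    {S : Set V} (hv : v ∈ S) (hr : r ∉ S) : ∃ e ∈ F, Crosses S e := by
  obtain ⟨p⟩ := h
  obtain ⟨d, -, h1, h2⟩ := p.exists_boundary_dart S hv hr
  have := d.adj
  rw [SimpleGraph.fromEdgeSet_adj] at this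
  exact ⟨s(d.fst, d.snd), this.1, d.fst, h1, d.snd, h2, rfl⟩

lemma FracConn.mono {V : Type*} {E : Finset (Sym2 V)} {x x' : Sym2 V → ℝ} {r : V} {c : ℝ} {v : V}
    (hx : ∀ e ∈ E, x e ≤ x' e) (h : FracConn E x r c v) : FracConn E x' r c v := by
  classical
  intro S hv hr
  refine (h S hv hr).trans (Finset.sum_le_sum fun e he => hx e ?_)
  exact (Finset.mem_filter.1 he).1

/-- A discrete coarea inequality. -/
lemma FracConn.mul_le_sum_edgeDiff {V : Type*} [Fintype V] {E : Finset (Sym2 V)}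
    {x : Sym2 V → ℝ} {r : V} {c : ℝ} {v : V} (hx : ∀ e ∈ E, 0 ≤ x e)
    (h : FracConn E x r c v) (φ : V → ℝ) (hφ : ∀ u, 0 ≤ φ u) (hr : φ r = 0) :
    c * φ v ≤ ∑ e ∈ E, x e * edgeDiff φ e := by
  classical
  induction hk : (Finset.univ.filter fun u => 0 < φ u).card using Nat.strong_induction_on
    generalizing φ with
  | _ k ih =>
  rcases (hφ v).eq_or_lt with h0 | hpos
  · rw [← h0, mul_zero]
    exact Finset.sum_nonneg fun e he => mul_nonneg (hx e he) (edgeDiff_nonneg φ e)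
  obtain ⟨z, hz, hmin⟩ := Finset.exists_min_image (Finset.univ.filter fun u => 0 < φ u) φ
    ⟨v, by simpa using hpos⟩
  have hz0 : 0 < φ z := by simpa using hz
  have hmin' : ∀ u, 0 < φ u → φ z ≤ φ u := fun u hu => hmin u (by simpa using hu)
  set m := φ z with hm
  let ψ : V → ℝ := fun u => if 0 < φ u then φ u - m else 0
  have hψle : ∀ u, ψ u ≤ φ u := by
    intro u
    simp only [ψ]
    split_ifs <;> linarith [hφ u]
  have key : ∀ e, edgeDiff φ e =
      edgeDiff ψ e + m * (if Crosses {u | 0 < φ u} e then 1 else 0) := by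
    intro e
    induction e with
    | h a b =>
      simp only [edgeDiff_mk, crosses_mk, Set.mem_ofPred_eq, ψ]
      rcases (hφ a).eq_or_lt with ha | ha <;> rcases (hφ b).eq_or_lt with hb | hb
      · simp [← ha, ← hb]
      · have := hmin' b hb
        simp only [← ha, hb, lt_irrefl, if_true, if_false]
        rw [zero_sub, zero_sub, abs_neg, abs_neg, abs_of_pos hb, abs_of_nonneg (by linarith)]
        simp
      · have := hmin' a ha
        simp only [← hb, ha, lt_irrefl, if_true, if_false]
        rw [sub_zero, sub_zero, abs_of_pos ha, abs_of_nonneg (by linarith)]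
        simp
      · simp [ha, hb]
  have hψv : φ v = ψ v + m := by simp [ψ, hpos]
  have hlt : (Finset.univ.filter fun u => 0 < ψ u).card < k := by
    rw [← hk]
    apply Finset.card_lt_card
    rw [Finset.ssubset_iff_of_subset]
    · exact ⟨z, hz, by simp [ψ, hm]⟩
    · intro u hu
      simp only [Finset.mem_filter, Finset.mem_univ, true_and] at hu ⊢
      exact hu.trans_le (hψle u)
  have hψ0 : ∀ u, 0 ≤ ψ u := by
    intro u
    simp only [ψ]
    split_ifs with hu
    · linarith [hmin' u hu]
    · exact le_rfl
  have hrec := ih _ hlt ψ hψ0 (by simp [ψ, hr]) rfl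
  have hcut := h {u | 0 < φ u} hpos (by simp [hr])
  have hsum : ∑ e ∈ E, x e * edgeDiff φ e = ∑ e ∈ E, x e * edgeDiff ψ e
      + m * ∑ e ∈ E with Crosses {u | 0 < φ u} e, x e := by
    rw [Finset.sum_filter, Finset.mul_sum, ← Finset.sum_add_distrib]
    refine Finset.sum_congr rfl fun e _ => ?_
    rw [key]
    split_ifs <;> ring
  rw [hsum, hψv]
  nlinarith [mul_le_mul_of_nonneg_left hcut hz0.le]

/-- The shortest-path metric of the edge weights `w` on a connected edge set `E`. -/
structure IsPathMetric {V : Type*} (E : Finset (Sym2 V)) (w : Sym2 V → ℝ) (d : V → V → ℝ) :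
    Prop where
  self : ∀ u, d u u = 0
  symm : ∀ u v, d u v = d v u
  triangle : ∀ u v z, d u z ≤ d u v + d v z
  nonneg : ∀ u v, 0 ≤ d u v
  le_weight : ∀ a b, s(a, b) ∈ E → d a b ≤ w s(a, b)
  exists_edges : ∀ u v, ∃ F ⊆ E, EdgeConn (↑F) u v ∧ ∑ e ∈ F, w e = d u v

lemma exists_isPathMetric {V : Type*} {E : Finset (Sym2 V)} {w : Sym2 V → ℝ}
    (hw : ∀ e ∈ E, 0 ≤ w e) (hE : ∀ u v, EdgeConn (E : Set (Sym2 V)) u v) :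
    ∃ d, IsPathMetric E w d := by
  classical
  have hex : ∀ u v : V, ∃ F ⊆ E, EdgeConn (F : Set (Sym2 V)) u v ∧
      ∀ F' ⊆ E, EdgeConn (F' : Set (Sym2 V)) u v → ∑ e ∈ F, w e ≤ ∑ e ∈ F', w e := by
    intro u v
    obtain ⟨F, hF, hmin⟩ := Finset.exists_min_image
      (E.powerset.filter fun F : Finset (Sym2 V) => EdgeConn (F : Set (Sym2 V)) u v)
      (fun F => ∑ e ∈ F, w e) ⟨E, by simpa using hE u v⟩
    simp only [Finset.mem_filter, Finset.mem_powerset] at hF hmin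
    exact ⟨F, hF.1, hF.2, fun F' h1 h2 => hmin F' ⟨h1, h2⟩⟩
  choose F hFE hF hmin using hex
  have hnn : ∀ F ⊆ E, 0 ≤ ∑ e ∈ F, w e :=
    fun F hF => Finset.sum_nonneg fun e he => hw e (hF he)
  refine ⟨fun u v => ∑ e ∈ F u v, w e, ?_, ?_, ?_, ?_, ?_, ?_⟩
  · intro u
    refine le_antisymm ?_ (hnn _ (hFE u u))
    simpa using hmin u u ∅ (by simp) (SimpleGraph.Reachable.refl _)
  · intro u v
    exact le_antisymm (hmin _ _ _ (hFE v u) (SimpleGraph.Reachable.symm (hF v u)))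
      (hmin _ _ _ (hFE u v) (SimpleGraph.Reachable.symm (hF u v)))
  · intro u v z
    refine (hmin u z (F u v ∪ F v z) (Finset.union_subset (hFE _ _) (hFE _ _)) ?_).trans ?_
    · exact SimpleGraph.Reachable.trans ((hF u v).mono (by simp)) ((hF v z).mono (by simp))
    · rw [← Finset.sum_union_inter]
      linarith [hnn (F u v ∩ F v z) (Finset.inter_subset_left.trans (hFE _ _))]
  · exact fun u v => hnn _ (hFE u v)
  · intro a b hab
    by_cases hne : a = b
    · subst hne
      refine (hmin a a ∅ (by simp) (SimpleGraph.Reachable.refl _)).trans ?_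
      simpa using hw _ hab
    · simpa using hmin a b {s(a, b)} (by simpa using hab)
        (SimpleGraph.Adj.reachable (by simp [hne]))
  · exact fun u v => ⟨F u v, hFE u v, hF u v, rfl⟩

/-- Disjoint balls of radius `ρ / 2` form a dual lower bound for fractional connectivity. -/
lemma card_mul_le_of_separated {V : Type*} [Fintype V] {E : Finset (Sym2 V)} {w x : Sym2 V → ℝ}
    {d : V → V → ℝ} (hd : IsPathMetric E w d) (hx : ∀ e ∈ E, 0 ≤ x e) {r : V} {c ρ : ℝ}
    (hρ : 0 < ρ) {K : Finset V} (hsep : ∀ u ∈ K, ∀ v ∈ K, u ≠ v → ρ ≤ d u v)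
    (hr : ∀ v ∈ K, ρ ≤ d v r) (hK : ∀ v ∈ K, FracConn E x r c v) :
    (K.card : ℝ) * (c * (ρ / 2)) ≤ 2 * ∑ e ∈ E, x e * w e := by
  classical
  let φ : V → V → ℝ := fun v u => max 0 (ρ / 2 - d v u)
  have hcard : ∀ a, ((K.filter fun v => d v a < ρ / 2).card : ℝ) ≤ 1 := by
    intro a
    have : (K.filter fun v => d v a < ρ / 2).card ≤ 1 := by
      rw [Finset.card_le_one]
      intro u hu v hv
      simp only [Finset.mem_filter] at hu hv
      by_contra hne
      linarith [hsep u hu.1 v hv.1 hne, hd.triangle u a v, hd.symm a v]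
    exact_mod_cast this
  have hdiff : ∀ v a b, s(a, b) ∈ E → edgeDiff (φ v) s(a, b) ≤
      w s(a, b) * ((if d v a < ρ / 2 then 1 else 0) + (if d v b < ρ / 2 then 1 else 0)) := by
    intro v a b hab
    have hw := hd.le_weight a b hab
    have h0 := hd.nonneg a b
    have h1 := hd.triangle v a b
    have h2 := hd.triangle v b a
    have h3 := hd.symm a b
    simp only [edgeDiff_mk, φ]
    split_ifs with ha hb hb
    · rw [max_eq_right (by linarith), max_eq_right (by linarith), abs_le]
      constructor <;> linarith
    · rw [max_eq_right (by linarith), max_eq_left (by linarith), abs_le]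
      constructor <;> linarith
    · rw [max_eq_left (by linarith), max_eq_right (by linarith), abs_le]
      constructor <;> linarith
    · rw [max_eq_left (by linarith), max_eq_left (by linarith)]
      simp
  have hedge : ∀ e ∈ E, ∑ v ∈ K, edgeDiff (φ v) e ≤ 2 * w e := by
    intro e
    induction e with
    | h a b =>
      intro hab
      refine (Finset.sum_le_sum fun v _ => hdiff v a b hab).trans ?_
      rw [← Finset.mul_sum, Finset.sum_add_distrib, Finset.sum_boole, Finset.sum_boole]
      nlinarith [hcard a, hcard b, hd.le_weight a b hab, hd.nonneg a b]
  calc (K.card : ℝ) * (c * (ρ / 2)) = ∑ v ∈ K, c * (ρ / 2) := by simp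
    _ ≤ ∑ v ∈ K, ∑ e ∈ E, x e * edgeDiff (φ v) e := by
        refine Finset.sum_le_sum fun v hv => ?_
        have := (hK v hv).mul_le_sum_edgeDiff hx (φ v) (fun u => le_max_left _ _)
          (max_eq_left (by linarith [hr v hv]))
        simpa [φ, hd.self v, max_eq_right hρ.le, (half_pos hρ).le] using this
    _ = ∑ e ∈ E, x e * ∑ v ∈ K, edgeDiff (φ v) e := by
        rw [Finset.sum_comm]
        simp only [Finset.mul_sum]
    _ ≤ ∑ e ∈ E, x e * (2 * w e) :=
        Finset.sum_le_sum fun e he => mul_le_mul_of_nonneg_left (hedge e he) (hx e he)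
    _ = 2 * ∑ e ∈ E, x e * w e := by
        rw [Finset.mul_sum]
        exact Finset.sum_congr rfl fun e _ => by ring

/-- A weak-`L¹` bound on `d` gives a bound on its sum, at the price of a harmonic factor. -/
lemma sum_le_mul_harmonic {ι : Type*} (d : ι → ℝ) (M : ℝ) (hM : 0 ≤ M) (T : Finset ι)
    (h : ∀ ρ > 0, ((T.filter fun v => ρ ≤ d v).card : ℝ) * ρ ≤ M) :
    ∑ v ∈ T, d v ≤ M * (harmonic T.card : ℝ) := by
  classical
  induction hk : T.card generalizing T with
  | zero => simp [Finset.card_eq_zero.1 hk]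
  | succ k ih =>
    obtain ⟨z, hz, hmin⟩ := Finset.exists_min_image T d (Finset.card_pos.1 (by omega))
    have hrec := ih (T.erase z) (fun ρ hρ => by
      refine le_trans ?_ (h ρ hρ)
      gcongr
      exact Finset.erase_subset _ _) (by rw [Finset.card_erase_of_mem hz]; omega)
    have hz' : d z ≤ M * ((k : ℝ) + 1)⁻¹ := by
      rcases le_or_gt (d z) 0 with h0 | h0
      · exact h0.trans (by positivity)
      · have := h (d z) h0
        rw [Finset.filter_true_of_mem hmin, hk] at this
        push_cast at this
        rw [← div_eq_mul_inv, le_div_iff₀ (by positivity)]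
        linarith
    rw [← Finset.add_sum_erase _ _ hz, harmonic_succ]
    push_cast
    linarith

/-- `H` is an edge set connecting `T` to `r` as built by the greedy online Steiner tree
algorithm. -/
def IsGreedyTree {V : Type*} (E : Finset (Sym2 V)) (w : Sym2 V → ℝ) (d : V → V → ℝ) (r : V)
    (T : Finset V) (H : Finset (Sym2 V)) : Prop :=
  H ⊆ E ∧ (∀ v ∈ T, EdgeConn (H : Set (Sym2 V)) v r) ∧
    ∃ c : V → ℝ, ∑ e ∈ H, w e ≤ ∑ v ∈ T, c v ∧ (∀ v ∈ T, c v ≤ d v r) ∧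
      ∀ u ∈ T, ∀ v ∈ T, u ≠ v → min (c u) (c v) ≤ d u v

lemma IsGreedyTree.exists_insert {V : Type*} [DecidableEq V] {E : Finset (Sym2 V)}
    {w : Sym2 V → ℝ} {d : V → V → ℝ} (hd : IsPathMetric E w d) (hw : ∀ e ∈ E, 0 ≤ w e) {r : V}
    {T : Finset V} {H : Finset (Sym2 V)} (h : IsGreedyTree E w d r T H) {v : V} (hv : v ∉ T) :
    ∃ H', H ⊆ H' ∧ IsGreedyTree E w d r (insert v T) H' := by
  classical
  obtain ⟨hHE, hconn, c, hcost, hcr, hsep⟩ := h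
  obtain ⟨z, hz, hmin⟩ := Finset.exists_min_image (insert r T) (fun u => d v u) ⟨r, by simp⟩
  obtain ⟨F, hFE, hF, hFw⟩ := hd.exists_edges v z
  have hupd : ∀ u ∈ T, Function.update c v (d v z) u = c u := fun u hu =>
    Function.update_of_ne (ne_of_mem_of_not_mem hu hv) _ _
  refine ⟨H ∪ F, Finset.subset_union_left, Finset.union_subset hHE hFE, ?_,
    Function.update c v (d v z), ?_, ?_, ?_⟩
  · intro u hu
    rcases Finset.mem_insert.1 hu with rfl | hu
    · refine SimpleGraph.Reachable.trans (hF.mono (by simp)) ?_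
      rcases Finset.mem_insert.1 hz with rfl | hz
      · exact SimpleGraph.Reachable.refl _
      · exact (hconn z hz).mono (by simp)
    · exact (hconn u hu).mono (by simp)
  · rw [Finset.sum_insert hv, Function.update_self, Finset.sum_congr rfl hupd, ← hFw]
    have := Finset.sum_union_inter (s₁ := H) (s₂ := F) (f := w)
    have h0 : 0 ≤ ∑ e ∈ H ∩ F, w e :=
      Finset.sum_nonneg fun e he => hw e (hFE (Finset.mem_inter.1 he).2)
    linarith
  · intro u hu
    rcases Finset.mem_insert.1 hu with rfl | hu
    · rw [Function.update_self]
      exact hmin r (by simp)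
    · rw [hupd u hu]
      exact hcr u hu
  · intro a ha b hb hab
    rcases Finset.mem_insert.1 ha with rfl | ha' <;>
      rcases Finset.mem_insert.1 hb with rfl | hb'
    · exact absurd rfl hab
    · rw [Function.update_self]
      exact (min_le_left _ _).trans (hmin b (by simp [hb']))
    · rw [Function.update_self, hd.symm a]
      exact (min_le_right _ _).trans (hmin a (by simp [ha']))
    · rw [hupd a ha', hupd b hb']
      exact hsep a ha' b hb' hab

lemma IsGreedyTree.exists_extend {V : Type*} {E : Finset (Sym2 V)}
    {w : Sym2 V → ℝ} {d : V → V → ℝ} (hd : IsPathMetric E w d) (hw : ∀ e ∈ E, 0 ≤ w e) {r : V}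
    {T : Finset V} {H : Finset (Sym2 V)} (h : IsGreedyTree E w d r T H)
    {T' : Finset V} (hT : T ⊆ T') : ∃ H', H ⊆ H' ∧ IsGreedyTree E w d r T' H' := by
  classical
  suffices hS : ∀ S : Finset V, ∃ H', H ⊆ H' ∧ IsGreedyTree E w d r (T ∪ S) H' by
    simpa [Finset.union_eq_right.2 hT] using hS T'
  intro S
  induction S using Finset.induction_on with
  | empty => exact ⟨H, subset_rfl, by simpa using h⟩
  | insert v S _ ih =>
    obtain ⟨H', hHH', h'⟩ := ih
    rw [Finset.union_insert]
    by_cases hv : v ∈ T ∪ S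
    · exact ⟨H', hHH', by rwa [Finset.insert_eq_of_mem hv]⟩
    · obtain ⟨H'', h1, h2⟩ := h'.exists_insert hd hw hv
      exact ⟨H'', hHH'.trans h1, h2⟩

lemma IsGreedyTree.cost_le {V : Type*} [Fintype V] {E : Finset (Sym2 V)} {w x : Sym2 V → ℝ}
    {d : V → V → ℝ} (hd : IsPathMetric E w d) (hx : ∀ e ∈ E, 0 ≤ x e) (hw : ∀ e ∈ E, 0 ≤ w e)
    {r : V} {c : ℝ} (hc : 0 < c) {T : Finset V} {H : Finset (Sym2 V)}
    (h : IsGreedyTree E w d r T H) (hT : ∀ v ∈ T, FracConn E x r c v) :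
    ∑ e ∈ H, w e ≤ 4 / c * (∑ e ∈ E, x e * w e) * (1 + Real.log (Fintype.card V)) := by
  classical
  obtain ⟨-, -, k, hcost, hkr, hsep⟩ := h
  have hW : 0 ≤ ∑ e ∈ E, x e * w e := Finset.sum_nonneg fun e he => mul_nonneg (hx e he) (hw e he)
  have hsum := sum_le_mul_harmonic k (4 / c * ∑ e ∈ E, x e * w e) (by positivity) T (by
    intro ρ hρ
    have := card_mul_le_of_separated (K := T.filter fun v => ρ ≤ k v) hd hx hρ
      (fun u hu v hv huv => by
        simp only [Finset.mem_filter] at hu hv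
        exact (le_min hu.2 hv.2).trans (hsep u hu.1 v hv.1 huv))
      (fun v hv => by
        simp only [Finset.mem_filter] at hv
        exact hv.2.trans (hkr v hv.1))
      (fun v hv => hT v (Finset.mem_filter.1 hv).1)
    rw [div_mul_eq_mul_div, le_div_iff₀ hc]
    linarith)
  refine hcost.trans (hsum.trans (mul_le_mul_of_nonneg_left ?_ (by positivity)))
  rcases Nat.eq_zero_or_pos T.card with h0 | h0
  · have : 0 ≤ Real.log (Fintype.card V) := Real.log_natCast_nonneg _
    rw [h0, harmonic_zero]
    push_cast
    linarith
  · refine (harmonic_le_one_add_log _).trans ?_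
    have : (T.card : ℝ) ≤ Fintype.card V := by exact_mod_cast Finset.card_le_univ T
    have := Real.log_le_log (by exact_mod_cast h0) this
    linarith

/-- The edge capacities described by the multiplicative weights `y` on a graph with `n`
vertices. -/
noncomputable def weightCap {V : Type*} (n : ℕ) (y : Sym2 V → ℝ) (e : Sym2 V) : ℝ :=
  (y e - 1) / (2 * (n : ℝ) ^ 3)

open Classical in
/-- The vertices that are fractionally connected to `r` to an extent of at least `c`. -/
noncomputable def fracTerminals {V : Type*} [Fintype V] (E : Finset (Sym2 V)) (x : Sym2 V → ℝ)
    (r : V) (c : ℝ) : Finset V :=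
  {v | FracConn E x r c v}

lemma mem_fracTerminals {V : Type*} [Fintype V] {E : Finset (Sym2 V)} {x : Sym2 V → ℝ}
    {r : V} {c : ℝ} {v : V} : v ∈ fracTerminals E x r c ↔ FracConn E x r c v := by
  simp [fracTerminals]

lemma fracTerminals_weightCap_mono {V : Type*} [Fintype V] {E : Finset (Sym2 V)} (n : ℕ)
    {y y' : Sym2 V → ℝ} (h : ∀ e ∈ E, y e ≤ y' e) (r : V) (c : ℝ) :
    fracTerminals E (weightCap n y) r c ⊆ fracTerminals E (weightCap n y') r c := by
  intro v
  simp only [mem_fracTerminals]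
  refine FracConn.mono fun e he => ?_
  have := h e he
  unfold weightCap
  gcongr

/-- The fractional terminals `T` contain at least a `(1 - ε) / 2` fraction of `g`. -/
def Covers {V : Type*} (T : Finset V) (ε : ℝ) (g : Set V) : Prop :=
  (1 - ε) * ((g.ncard : ℝ) / 2) ≤ ((g ∩ T).ncard : ℝ)

lemma Covers.mono {V : Type*} [Finite V] {T T' : Finset V} (hT : T ⊆ T') {ε : ℝ} {g : Set V}
    (h : Covers T ε g) : Covers T' ε g := by
  refine h.trans ?_
  have : (g ∩ T).ncard ≤ (g ∩ T').ncard :=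
    Set.ncard_le_ncard (Set.inter_subset_inter_right _ (by exact_mod_cast hT)) (Set.toFinite _)
  exact_mod_cast this

lemma half_le_log_one_add {z : ℝ} (h0 : 0 ≤ z) (h1 : z ≤ 1) : z / 2 ≤ Real.log (1 + z) := by
  refine le_trans ?_ (Real.one_sub_inv_le_log_of_pos (by linarith))
  have : 1 - (1 + z)⁻¹ = z / (1 + z) := by
    field_simp
    ring
  rw [this]
  gcongr
  linarith

lemma card_edges_le {V : Type*} [Fintype V] {G : SimpleGraph V} {E : Finset (Sym2 V)}
    (hE : (E : Set (Sym2 V)) ⊆ G.edgeSet) : E.card ≤ Fintype.card V ^ 2 := by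
  classical
  have h : E ⊆ G.edgeFinset := by
    intro e he
    simpa using hE he
  refine (Finset.card_le_card h).trans (G.card_edgeFinset_le_card_choose_two.trans ?_)
  exact Nat.choose_le_pow _ _

/-- One multiplicative-weights update for an uncovered group. -/
lemma exists_weight_update {V : Type*} [Fintype V] {E : Finset (Sym2 V)} {w : Sym2 V → ℝ}
    (hw : ∀ e ∈ E, 1 ≤ w e) (hcard : E.card ≤ Fintype.card V ^ 2)
    (hn : 2 ≤ Fintype.card V) {r : V} {ε : ℝ} (hε0 : 0 < ε) (hε1 : ε < 1)
    {y : Sym2 V → ℝ} (hy1 : ∀ e ∈ E, 1 ≤ y e)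
    (hyn : ∀ e ∈ E, y e ≤ (Fintype.card V : ℝ) ^ 6) {g : Set V}
    (hg : ¬ Covers (fracTerminals E (weightCap (Fintype.card V) y) r (ε / 2)) ε g) :
    ∃ (y' : Sym2 V → ℝ) (b : ℝ), 1 / 2 ≤ b ∧ (∀ e ∈ E, y e ≤ y' e) ∧
      (∀ e ∈ E, y' e ≤ (Fintype.card V : ℝ) ^ 6) ∧
      ∑ e ∈ E, weightCap (Fintype.card V) y' e * w e ≤
        ∑ e ∈ E, weightCap (Fintype.card V) y e * w e + 2 * b / Fintype.card V ∧
      ∀ F ⊆ E, (g.ncard : ℝ) / 2 ≤ connVerts r F g →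
        ∑ e ∈ F, w e * Real.log (y e) + b / (2 * Fintype.card V) ≤
          ∑ e ∈ F, w e * Real.log (y' e) := by
  classical
  set n := Fintype.card V with hn_def
  set T := fracTerminals E (weightCap n y) r (ε / 2) with hT
  have hn2 : (2 : ℝ) ≤ n := by exact_mod_cast hn
  have hn0 : (0 : ℝ) < n := by linarith
  have hn3 : (8 : ℝ) ≤ (n : ℝ) ^ 3 := by
    calc (8 : ℝ) = 2 ^ 3 := by norm_num
      _ ≤ (n : ℝ) ^ 3 := by gcongr
  have hx0 : ∀ e ∈ E, 0 ≤ weightCap n y e := fun e he =>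
    div_nonneg (by linarith [hy1 e he]) (by positivity)
  let B : Finset V := Finset.univ.filter fun v => v ∈ g ∧ v ∉ T
  have hB : ∀ v, v ∈ B ↔ v ∈ g ∧ v ∉ T := by simp [B]
  have hBcard : g.ncard = (g ∩ T).ncard + B.card := by
    rw [← Set.ncard_inter_add_ncard_sdiff_eq_ncard g T (Set.toFinite _), ← Set.ncard_coe_finset B]
    congr 2
    ext v
    simp [hB]
  have hBcard' : (g.ncard : ℝ) = ((g ∩ T).ncard : ℝ) + B.card := by exact_mod_cast hBcard
  have hcut : ∀ v, ∃ S : Set V, v ∈ B → v ∈ S ∧ r ∉ S ∧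
      ∑ e ∈ E with Crosses S e, weightCap n y e < ε / 2 := by
    intro v
    by_cases hv : v ∈ B
    · have := ((hB v).1 hv).2
      rw [hT, mem_fracTerminals, FracConn] at this
      push Not at this
      obtain ⟨S, h1, h2, h3⟩ := this
      exact ⟨S, fun _ => ⟨h1, h2, h3⟩⟩
    · exact ⟨∅, fun h => absurd h hv⟩
  choose S hS using hcut
  let c : Sym2 V → ℕ := fun e => (B.filter fun v => Crosses (S v) e).card
  have hcn : ∀ e, (c e : ℝ) ≤ n := fun e => by
    exact_mod_cast (Finset.card_le_univ _ : (B.filter fun v => Crosses (S v) e).card ≤ _)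
  have hcsum : ∀ (F : Finset (Sym2 V)) (f : Sym2 V → ℝ), ∑ e ∈ F, (c e : ℝ) * f e =
      ∑ v ∈ B, ∑ e ∈ F with Crosses (S v) e, f e := by
    intro F f
    simp only [Finset.sum_filter]
    rw [Finset.sum_comm]
    refine Finset.sum_congr rfl fun e _ => ?_
    rw [← Finset.sum_filter, Finset.sum_const, nsmul_eq_mul]
  set b : ℝ := (g.ncard : ℝ) / 2 - ((g ∩ T).ncard : ℝ) with hb
  have hbε : ε * ((g.ncard : ℝ) / 2) < b := by
    rw [Covers, not_le] at hg
    linarith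
  have hb12 : 1 / 2 ≤ b := by
    have h0 : 0 < b := lt_of_le_of_lt (by positivity) hbε
    have h1 : 2 * (g ∩ T).ncard < g.ncard := by
      have : (2 * (g ∩ T).ncard : ℝ) < g.ncard := by linarith
      exact_mod_cast this
    have h2 : (2 * (g ∩ T).ncard + 1 : ℝ) ≤ g.ncard := by exact_mod_cast h1
    linarith
  have hcx : ∑ e ∈ E, (c e : ℝ) * weightCap n y e ≤ b := by
    rw [hcsum]
    calc _ ≤ ∑ v ∈ B, ε / 2 := Finset.sum_le_sum fun v hv => (hS v hv).2.2.le
      _ = B.card * (ε / 2) := by simp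
      _ ≤ g.ncard * (ε / 2) := by
        gcongr
        omega
      _ ≤ b := by linarith
  have hcE : ∑ e ∈ E, (c e : ℝ) ≤ (n : ℝ) ^ 3 := by
    calc _ ≤ ∑ e ∈ E, (n : ℝ) := Finset.sum_le_sum fun e _ => hcn e
      _ = E.card * n := by simp
      _ ≤ (n : ℝ) ^ 2 * n := by
        gcongr
        exact_mod_cast hcard
      _ = (n : ℝ) ^ 3 := by ring
  have hz0 : ∀ e ∈ E, 0 ≤ (c e : ℝ) / (n * w e) := fun e he => by
    have := hw e he
    positivity
  have hz1 : ∀ e ∈ E, (c e : ℝ) / (n * w e) ≤ 1 := fun e he => by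
    have := hw e he
    rw [div_le_one (by positivity)]
    nlinarith [hcn e]
  refine ⟨fun e => y e * (1 + c e / (n * w e)), b, hb12, ?_, ?_, ?_, ?_⟩
  · intro e he
    nlinarith [hy1 e he, hz0 e he]
  · intro e he
    rcases Nat.eq_zero_or_pos (c e) with h0 | h0
    · simpa [h0] using hyn e he
    · obtain ⟨v, hv⟩ := Finset.card_pos.1 h0
      rw [Finset.mem_filter] at hv
      have h1 : weightCap n y e < ε / 2 :=
        lt_of_le_of_lt (Finset.single_le_sum (f := weightCap n y)
          (fun e he => hx0 e (Finset.mem_filter.1 he).1)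
          (Finset.mem_filter.2 ⟨he, hv.2⟩)) (hS v hv.1).2.2
      have h2 : y e ≤ (n : ℝ) ^ 3 + 1 := by
        rw [weightCap, div_lt_iff₀ (by positivity)] at h1
        nlinarith
      have h3 : (n : ℝ) ^ 6 = (n : ℝ) ^ 3 * (n : ℝ) ^ 3 := by ring
      rw [h3]
      nlinarith [hz1 e he, hy1 e he]
  · have hterm : ∀ e ∈ E, weightCap n (fun e => y e * (1 + c e / (n * w e))) e * w e =
        weightCap n y e * w e + (c e * weightCap n y e + c e * (1 / (2 * (n : ℝ) ^ 3))) / n := by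
      intro e he
      have : w e ≠ 0 := by linarith [hw e he]
      unfold weightCap
      field_simp
      ring
    rw [Finset.sum_congr rfl hterm, Finset.sum_add_distrib, ← Finset.sum_div,
      Finset.sum_add_distrib, ← Finset.sum_mul]
    have h1 : (∑ e ∈ E, (c e : ℝ)) * (1 / (2 * (n : ℝ) ^ 3)) ≤ 1 / 2 := by
      rw [mul_one_div, div_le_iff₀ (by positivity)]
      linarith
    gcongr
    linarith
  · intro F hF hFg
    have hFc : b ≤ ∑ e ∈ F, (c e : ℝ) := by
      have h1 := hcsum F fun _ => 1
      simp only [mul_one] at h1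
      have hsub : {v ∈ g | EdgeConn (F : Set (Sym2 V)) v r} ⊆
          (g ∩ T) ∪ (B.filter fun v => EdgeConn (F : Set (Sym2 V)) v r : Finset V) := by
        intro v hv
        by_cases hvT : v ∈ T
        · exact Or.inl ⟨hv.1, hvT⟩
        · exact Or.inr (by simpa [hB] using ⟨⟨hv.1, hvT⟩, hv.2⟩)
      have h2 := (Set.ncard_le_ncard hsub (Set.toFinite _)).trans (Set.ncard_union_le _ _)
      rw [Set.ncard_coe_finset] at h2
      have h3 : (connVerts r F g : ℝ) ≤ ((g ∩ T).ncard : ℝ) +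
          ((B.filter fun v => EdgeConn (F : Set (Sym2 V)) v r).card : ℝ) := by exact_mod_cast h2
      have h4 : ((B.filter fun v => EdgeConn (F : Set (Sym2 V)) v r).card : ℝ) ≤
          ∑ v ∈ B, ∑ e ∈ F with Crosses (S v) e, (1 : ℝ) := by
        rw [← Finset.sum_boole]
        refine Finset.sum_le_sum fun v hv => ?_
        rw [Finset.sum_const, nsmul_eq_mul, mul_one]
        split_ifs with hc
        · obtain ⟨e, he, hcr⟩ := hc.exists_crosses (hS v hv).1 (hS v hv).2.1
          have : 1 ≤ (F.filter fun e => Crosses (S v) e).card :=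
            Finset.card_pos.2 ⟨e, Finset.mem_filter.2 ⟨he, hcr⟩⟩
          exact_mod_cast this
        · positivity
      linarith
    calc ∑ e ∈ F, w e * Real.log (y e) + b / (2 * n)
        ≤ ∑ e ∈ F, w e * Real.log (y e) + (∑ e ∈ F, (c e : ℝ)) / (2 * n) := by gcongr
      _ = ∑ e ∈ F, (w e * Real.log (y e) + c e / (2 * n)) := by
        rw [Finset.sum_add_distrib, Finset.sum_div]
      _ ≤ _ := by
        refine Finset.sum_le_sum fun e he => ?_
        have hwe := hw e (hF he)
        have hye := hy1 e (hF he)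
        have hz := hz0 e (hF he)
        rw [Real.log_mul (by linarith) (by linarith), mul_add]
        have := mul_le_mul_of_nonneg_left (half_le_log_one_add hz (hz1 e (hF he)))
          (by linarith : (0 : ℝ) ≤ w e)
        have h5 : w e * ((c e : ℝ) / (n * w e) / 2) = c e / (2 * n) := by
          field_simp
        linarith

/-- Invariant of the multiplicative weights, compared to the offline solutions in `Q`. -/
structure IsWeight {V : Type*} [Fintype V] (E : Finset (Sym2 V)) (w : Sym2 V → ℝ)
    (Q : Finset (Sym2 V) → Prop) (y : Sym2 V → ℝ) : Prop where
  one_le : ∀ e ∈ E, 1 ≤ y e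
  le_pow : ∀ e ∈ E, y e ≤ (Fintype.card V : ℝ) ^ 6
  cost_le : ∀ F ⊆ E, Q F → ∑ e ∈ E, weightCap (Fintype.card V) y e * w e ≤
    4 * ∑ e ∈ F, w e * Real.log (y e)

lemma IsWeight.sum_mul_log_le {V : Type*} [Fintype V] {E : Finset (Sym2 V)} {w : Sym2 V → ℝ}
    {Q : Finset (Sym2 V) → Prop} {y : Sym2 V → ℝ} (h : IsWeight E w Q y)
    (hw : ∀ e ∈ E, 1 ≤ w e) {F : Finset (Sym2 V)} (hF : F ⊆ E) :
    ∑ e ∈ F, w e * Real.log (y e) ≤ 6 * Real.log (Fintype.card V) * ∑ e ∈ F, w e := by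
  rw [Finset.mul_sum]
  refine Finset.sum_le_sum fun e he => ?_
  have h1 := Real.log_le_log (by linarith [h.one_le e (hF he)]) (h.le_pow e (hF he))
  rw [Real.log_pow] at h1
  push_cast at h1
  nlinarith [hw e (hF he)]

lemma IsWeight.exists_covers {V : Type*} [Fintype V] {E : Finset (Sym2 V)} {w : Sym2 V → ℝ}
    (hw : ∀ e ∈ E, 1 ≤ w e) (hcard : E.card ≤ Fintype.card V ^ 2)
    (hn : 2 ≤ Fintype.card V) {r : V} {ε : ℝ} (hε0 : 0 < ε) (hε1 : ε < 1)
    {Q : Finset (Sym2 V) → Prop} {g : Set V}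
    (hQ : ∀ F, Q F → (g.ncard : ℝ) / 2 ≤ connVerts r F g)
    (hE : (g.ncard : ℝ) / 2 ≤ connVerts r E g) {y : Sym2 V → ℝ} (h : IsWeight E w Q y) :
    ∃ y', (∀ e ∈ E, y e ≤ y' e) ∧ IsWeight E w Q y' ∧
      Covers (fracTerminals E (weightCap (Fintype.card V) y') r (ε / 2)) ε g := by
  have hn0 : (0 : ℝ) < Fintype.card V := by
    have : 0 < Fintype.card V := by omega
    exact_mod_cast this
  set M : ℝ := 6 * Real.log (Fintype.card V) * ∑ e ∈ E, w e with hM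
  obtain ⟨k, hk⟩ : ∃ k : ℕ,
      M - ∑ e ∈ E, w e * Real.log (y e) ≤ k * (1 / (4 * (Fintype.card V : ℝ))) := by
    obtain ⟨k, hk⟩ := exists_nat_ge
      ((M - ∑ e ∈ E, w e * Real.log (y e)) / (1 / (4 * (Fintype.card V : ℝ))))
    exact ⟨k, (div_le_iff₀ (by positivity)).1 hk⟩
  induction k generalizing y with
  | zero =>
    by_contra! hcon
    obtain ⟨y', b, hb, hle, hpow, -, hF⟩ := exists_weight_update hw hcard hn hε0 hε1
      h.one_le h.le_pow (hcon y (fun _ _ => le_rfl) h)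
    have h1 := hF E subset_rfl hE
    have h2 : IsWeight E w (fun _ => False) y' :=
      ⟨fun e he => (h.one_le e he).trans (hle e he), hpow, fun _ _ h => h.elim⟩
    have h3 := h2.sum_mul_log_le hw subset_rfl
    have : 0 < b / (2 * (Fintype.card V : ℝ)) := by positivity
    simp only [Nat.cast_zero, zero_mul] at hk
    linarith
  | succ k ih =>
    by_cases hcov : Covers (fracTerminals E (weightCap (Fintype.card V) y) r (ε / 2)) ε g
    · exact ⟨y, fun _ _ => le_rfl, h, hcov⟩
    obtain ⟨y', b, hb, hle, hpow, hcost, hF⟩ := exists_weight_update hw hcard hn hε0 hε1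
      h.one_le h.le_pow hcov
    have h' : IsWeight E w Q y' := by
      refine ⟨fun e he => (h.one_le e he).trans (hle e he), hpow, fun F hFE hQF => ?_⟩
      have h1 := h.cost_le F hFE hQF
      have h2 := hF F hFE (hQ F hQF)
      have h3 : 2 * b / (Fintype.card V : ℝ) = 4 * (b / (2 * (Fintype.card V : ℝ))) := by
        field_simp
        ring
      linarith
    have h4 := hF E subset_rfl hE
    have h5 : 1 / (4 * (Fintype.card V : ℝ)) ≤ b / (2 * (Fintype.card V : ℝ)) := by
      rw [div_le_div_iff₀ (by positivity) (by positivity)]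
      nlinarith
    obtain ⟨y'', h6, h7⟩ := ih h' (by push_cast at hk; linarith)
    exact ⟨y'', fun e he => (hle e he).trans (h6 e he), h7⟩

/-- An online algorithm exists as soon as every one-step extension can be served while
maintaining an invariant. -/
lemma exists_online {α S : Type*} (P : List α → S → Prop) (R : S → S → Prop)
    (h0 : ∃ s, P [] s) (hs : ∀ l s g, P l s → ∃ s', R s s' ∧ P (l ++ [g]) s') :
    ∃ A : List α → S, ∀ l, P l (A l) ∧ ∀ g, R (A l) (A (l ++ [g])) := by
  classical
  obtain ⟨s₀, hs₀⟩ := h0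
  choose! f hf using hs
  let B : List α → S := fun l => List.rec s₀ (fun g l s => f l.reverse s g) l
  have hB : ∀ l : List α, P l.reverse (B l) := by
    intro l
    induction l with
    | nil => exact hs₀
    | cons g l ih =>
      rw [List.reverse_cons]
      exact (hf _ _ g ih).2
  refine ⟨fun l => B l.reverse, fun l => ⟨by simpa using hB l.reverse, fun g => ?_⟩⟩
  simp only [List.reverse_append]
  exact (hf _ _ g (hB l.reverse)).1

/-- There is a universal constant `C` such that on every weighted graph
`G` on `n ≥ 2` vertices with root `r`, for every `ε ∈ (0,1)`, there is an online algorithm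
for online partial group Steiner tree (the `f`-partial problem with `fᵢ = |gᵢ|/2`) that
connects at least `(1−ε)·|gᵢ|/2` vertices of each group `gᵢ` to `r` and whose cost is at
most `C·(log³n/ε)·OPT_t` for every request sequence and every `t`. -/
theorem onlinePartialGST_half :
    ∃ C : ℝ, 0 < C ∧
      ∀ (V : Type) [Fintype V], ∀ (G : SimpleGraph V) (w : Sym2 V → ℝ) (r : V),
        2 ≤ Fintype.card V → G.Connected → (∀ e ∈ G.edgeSet, 1 ≤ w e) →
        ∀ ε : ℝ, 0 < ε → ε < 1 →
        ∃ A : List (Set V) → Finset (Sym2 V),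
          -- solutions are edge sets of `G`
          (∀ l : List (Set V), (∀ g ∈ l, g.Nonempty) → ↑(A l) ⊆ G.edgeSet) ∧
          -- the solution only grows under one-step extensions
          (∀ (l : List (Set V)) (g : Set V), (∀ g' ∈ l ++ [g], g'.Nonempty) →
            A l ⊆ A (l ++ [g])) ∧
          -- connects at least `(1−ε)·|gᵢ|/2` vertices of each group to the root
          (∀ l : List (Set V), (∀ g ∈ l, g.Nonempty) → ∀ g ∈ l,
            (1 - ε) * ((g.ncard : ℝ) / 2) ≤ (connVerts r (A l) g : ℝ)) ∧
          -- cost at most `C·(log³n/ε)` times the cost of any offline solution that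
          -- connects at least `|gᵢ|/2` vertices of each group to the root
          (∀ l : List (Set V), (∀ g ∈ l, g.Nonempty) →
            ∀ F : Finset (Sym2 V), ↑F ⊆ G.edgeSet →
              (∀ g ∈ l, (g.ncard : ℝ) / 2 ≤ (connVerts r F g : ℝ)) →
              ∑ e ∈ A l, w e ≤
                C * (Real.log (Fintype.card V : ℝ) ^ 3 / ε) * ∑ e ∈ F, w e) := by
  classical
  refine ⟨1152, by norm_num, ?_⟩
  intro V _ G w r hn hG hw1 ε hε0 hε1
  set E : Finset (Sym2 V) := G.edgeFinset with hE_def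
  have hEG : (E : Set (Sym2 V)) = G.edgeSet := by simp [hE_def]
  have hw : ∀ e ∈ E, 1 ≤ w e := fun e he => hw1 e (by simpa [hE_def] using he)
  have hw0 : ∀ e ∈ E, 0 ≤ w e := fun e he => zero_le_one.trans (hw e he)
  have hconn : ∀ u v, EdgeConn (E : Set (Sym2 V)) u v := by
    intro u v
    rw [EdgeConn, hEG, SimpleGraph.fromEdgeSet_edgeSet]
    exact hG.preconnected u v
  have hfeas : ∀ g : Set V, (g.ncard : ℝ) / 2 ≤ connVerts r E g := by
    intro g
    have : connVerts r E g = g.ncard := by simp [connVerts, hconn]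
    rw [this]
    have : (0 : ℝ) ≤ g.ncard := Nat.cast_nonneg _
    linarith
  have hcard : E.card ≤ Fintype.card V ^ 2 := card_edges_le hEG.le
  obtain ⟨d, hd⟩ := exists_isPathMetric hw0 hconn
  let Q : List (Set V) → Finset (Sym2 V) → Prop := fun l F =>
    ∀ g ∈ l, (g.ncard : ℝ) / 2 ≤ connVerts r F g
  let T : (Sym2 V → ℝ) → Finset V := fun y =>
    fracTerminals E (weightCap (Fintype.card V) y) r (ε / 2)
  obtain ⟨A, hA⟩ := exists_online
    (P := fun l (s : (Sym2 V → ℝ) × Finset (Sym2 V)) => IsWeight E w (Q l) s.1 ∧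
      IsGreedyTree E w d r (T s.1) s.2 ∧ ∀ g ∈ l, Covers (T s.1) ε g)
    (R := fun s s' => s.2 ⊆ s'.2)
    (by
      have h0 : IsGreedyTree E w d r ∅ ∅ := ⟨by simp, by simp, 0, by simp⟩
      obtain ⟨H, -, hH⟩ := h0.exists_extend hd hw0 (Finset.empty_subset (T fun _ => 1))
      refine ⟨(fun _ => 1, H), ⟨fun _ _ => le_rfl, fun _ _ => ?_, fun _ _ _ => ?_⟩, hH, by simp⟩
      · exact one_le_pow₀ (by exact_mod_cast (by omega : 1 ≤ Fintype.card V))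
      · simp [weightCap])
    (by
      rintro l ⟨y, H⟩ g ⟨hy, hH, hcov⟩
      have hy' : IsWeight E w (Q (l ++ [g])) y :=
        ⟨hy.one_le, hy.le_pow, fun F hF hQ => hy.cost_le F hF fun g' hg' => hQ g' (by simp [hg'])⟩
      obtain ⟨z, hyz, hz, hzg⟩ := hy'.exists_covers hw hcard hn (r := r) hε0 hε1 (g := g)
        (fun F hF => hF g (by simp)) (hfeas g)
      have hT : T y ⊆ T z := fracTerminals_weightCap_mono _ hyz r _
      obtain ⟨H', hHH', hH'⟩ := hH.exists_extend hd hw0 hT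
      refine ⟨(z, H'), hHH', hz, hH', fun g' hg' => ?_⟩
      rcases List.mem_append.1 hg' with h | h
      · exact (hcov g' h).mono hT
      · rw [List.mem_singleton.1 h]
        exact hzg)
  refine ⟨fun l => (A l).2, fun l _ => ?_, fun l g _ => (hA l).2 g, fun l _ g hg => ?_,
    fun l _ F hF hQ => ?_⟩
  · rw [← hEG]
    exact_mod_cast (hA l).1.2.1.1
  · refine ((hA l).1.2.2 g hg).trans ?_
    have : (g ∩ T (A l).1).ncard ≤ connVerts r (A l).2 g :=
      Set.ncard_le_ncard (fun v hv => ⟨hv.1, (hA l).1.2.1.2.1 v hv.2⟩) (Set.toFinite _)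
    exact_mod_cast this
  · obtain ⟨hy, hH, -⟩ := (hA l).1
    have hFE : F ⊆ E := by
      rw [← hEG] at hF
      exact_mod_cast hF
    have hcost := hH.cost_le (x := weightCap (Fintype.card V) (A l).1) hd
      (fun e he => div_nonneg (by linarith [hy.one_le e he]) (by positivity)) hw0
      (half_pos hε0) (fun v hv => mem_fracTerminals.1 hv)
    have hfrac := hy.cost_le F hFE hQ
    have hlog := hy.sum_mul_log_le hw hFE
    set L := Real.log (Fintype.card V : ℝ) with hL
    have hL2 : 1 / 2 ≤ L := by
      have h1 : Real.log 2 ≤ L :=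
        Real.log_le_log (by norm_num) (by exact_mod_cast hn)
      linarith [Real.log_two_gt_d9]
    have hF0 : 0 ≤ ∑ e ∈ F, w e := Finset.sum_nonneg fun e he => hw0 e (hFE he)
    calc ∑ e ∈ (A l).2, w e
        ≤ 4 / (ε / 2) * (24 * L * ∑ e ∈ F, w e) * (1 + L) := by
          refine hcost.trans ?_
          gcongr
          linarith
      _ ≤ 4 / (ε / 2) * (24 * L * ∑ e ∈ F, w e) * (6 * L ^ 2) := by
          gcongr
          nlinarith
      _ = 1152 * (L ^ 3 / ε) * ∑ e ∈ F, w e := by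
          field_simp
          ring
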